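/- The function V is continuously differentiable on (0,∞) and twice continuously differentiable except possibly at ū*, ũ₁ and ũ₃; moreover LV(x) = 0 for x ∈ (0,ū*) ∪ (ũ₁,ũ₃) and LV(x) < 0 for x ∈ (ū*,ũ₁) ∪ (ũ₃,∞). -/

import Mathlib

open Set Filter Topology

noncomputable def Lop (mu sig : ℝ → ℝ) (lam : ℝ) (g : ℝ → ℝ) (x : ℝ) : ℝ :=
  (1/2) * (sig x)^2 * deriv (deriv g) x + mu x * deriv g x - lam * g x

noncomputable def Wron (g₁ g₂ : ℝ → ℝ) (x : ℝ) : ℝ :=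
  g₁ x * deriv g₂ x - g₂ x * deriv g₁ x

noncomputable def hfun (g₁ g₂ : ℝ → ℝ) (x : ℝ) : ℝ :=
  deriv (deriv g₂) x / deriv (deriv g₁) x

noncomputable def gb (g₁ g₂ : ℝ → ℝ) (β x : ℝ) : ℝ := g₂ x - β * g₁ x

noncomputable def gb' (g₁ g₂ : ℝ → ℝ) (β x : ℝ) : ℝ := deriv g₂ x - β * deriv g₁ x

noncomputable def gb'' (g₁ g₂ : ℝ → ℝ) (β x : ℝ) : ℝ :=
  deriv (deriv g₂) x - β * deriv (deriv g₁) x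

noncomputable def gam (k K : ℝ) (g₁ g₂ : ℝ → ℝ) (β x : ℝ) : ℝ :=
  k * (gb g₁ g₂ β x / gb' g₁ g₂ β x - x) + K

noncomputable def Jfun (k : ℝ) (g₁ g₂ : ℝ → ℝ) (β a₁ a₂ : ℝ) : ℝ :=
  k * (a₂ - a₁ - (gb g₁ g₂ β a₂ - gb g₁ g₂ β a₁) / gb' g₁ g₂ β a₂)

noncomputable def Vfun (k K cstar ctil bt ubar u1t u3t : ℝ) (g₁ g₂ : ℝ → ℝ) (x : ℝ) : ℝ :=
  if x < ubar then cstar * gb g₁ g₂ 1 x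
  else if x < u1t then k * x - K
  else if x < u3t then ctil * gb g₁ g₂ bt x
  else k * x - K

theorem ContDiff.hasDerivAt_of_two {g : ℝ → ℝ} (hg : ContDiff ℝ 2 g) (x : ℝ) :
    HasDerivAt g (deriv g x) x ∧ HasDerivAt (deriv g) (deriv (deriv g) x) x := by
  have h1 : ContDiff ℝ 1 (deriv g) :=
    ((contDiff_succ_iff_deriv (n := 1)).1 (by exact_mod_cast hg)).2.2
  exact ⟨((hg.differentiable (by norm_num)) x).hasDerivAt,
    ((h1.differentiable (by norm_num)) x).hasDerivAt⟩

theorem ContDiff.if_lt_of_deriv_eq {f g : ℝ → ℝ} (hf : ContDiff ℝ 1 f) (hg : ContDiff ℝ 1 g)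
    {a : ℝ} (h0 : f a = g a) (h1 : deriv f a = deriv g a) :
    ContDiff ℝ 1 (fun x => if x < a then f x else g x) := by
  have hdf : ∀ x, HasDerivAt f (deriv f x) x := fun x =>
    ((hf.differentiable (by norm_num)) x).hasDerivAt
  have hdg : ∀ x, HasDerivAt g (deriv g x) x := fun x =>
    ((hg.differentiable (by norm_num)) x).hasDerivAt
  have key : ∀ x, HasDerivAt (fun x => if x < a then f x else g x)
      (if a ≤ x then deriv g x else deriv f x) x := by
    intro x
    rcases lt_trichotomy x a with hx | rfl | hx
    · rw [if_neg hx.not_ge]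
      refine (hdf x).congr_of_eventuallyEq ?_
      filter_upwards [Iio_mem_nhds hx] with y hy
      exact if_pos hy
    · rw [if_pos le_rfl, ← hasDerivWithinAt_univ, ← Iio_union_Ici (a := x)]
      refine HasDerivWithinAt.union ?_ ?_
      · rw [← h1]
        exact (hdf x).hasDerivWithinAt.congr (fun y hy => if_pos hy) (by simp [h0])
      · exact (hdg x).hasDerivWithinAt.congr (fun y hy => if_neg (not_lt.2 hy)) (by simp)
    · rw [if_pos hx.le]
      refine (hdg x).congr_of_eventuallyEq ?_
      filter_upwards [Ioi_mem_nhds hx] with y hy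
      exact if_neg (not_lt.2 (le_of_lt hy))
  rw [contDiff_one_iff_deriv]
  refine ⟨fun x => (key x).differentiableAt, ?_⟩
  rw [show deriv (fun x => if x < a then f x else g x) =
    fun x => if a ≤ x then deriv g x else deriv f x from funext fun x => (key x).deriv]
  refine Continuous.if_le (hg.continuous_deriv (by norm_num)) (hf.continuous_deriv (by norm_num))
    continuous_const continuous_id ?_
  rintro x rfl
  exact h1.symm

theorem Lop_congr {mu sig : ℝ → ℝ} {lam x : ℝ} {f g : ℝ → ℝ} (h : f =ᶠ[𝓝 x] g) :
    Lop mu sig lam f x = Lop mu sig lam g x := by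
  simp only [Lop, h.deriv.deriv_eq, h.deriv_eq, h.eq_of_nhds]

theorem hasDerivAt_gb {g₁ g₂ : ℝ → ℝ} (h₁ : ContDiff ℝ 2 g₁) (h₂ : ContDiff ℝ 2 g₂) (β x : ℝ) :
    HasDerivAt (gb g₁ g₂ β) (gb' g₁ g₂ β x) x :=
  (h₂.hasDerivAt_of_two x).1.sub ((h₁.hasDerivAt_of_two x).1.const_mul β)

theorem hasDerivAt_gb' {g₁ g₂ : ℝ → ℝ} (h₁ : ContDiff ℝ 2 g₁) (h₂ : ContDiff ℝ 2 g₂) (β x : ℝ) :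
    HasDerivAt (gb' g₁ g₂ β) (gb'' g₁ g₂ β x) x :=
  (h₂.hasDerivAt_of_two x).2.sub ((h₁.hasDerivAt_of_two x).2.const_mul β)

theorem contDiff_const_mul_gb {g₁ g₂ : ℝ → ℝ} (h₁ : ContDiff ℝ 2 g₁) (h₂ : ContDiff ℝ 2 g₂)
    (c β : ℝ) : ContDiff ℝ 2 (fun x => c * gb g₁ g₂ β x) :=
  contDiff_const.mul (h₂.sub (contDiff_const.mul h₁))

theorem Lop_const_mul_gb {mu sig : ℝ → ℝ} {lam : ℝ} {g₁ g₂ : ℝ → ℝ}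
    (h₁ : ContDiff ℝ 2 g₁) (h₂ : ContDiff ℝ 2 g₂) {x : ℝ}
    (hL₁ : Lop mu sig lam g₁ x = 0) (hL₂ : Lop mu sig lam g₂ x = 0) (c β : ℝ) :
    Lop mu sig lam (fun x => c * gb g₁ g₂ β x) x = 0 := by
  have e : deriv (fun x => c * gb g₁ g₂ β x) = fun x => c * gb' g₁ g₂ β x :=
    funext fun y => ((hasDerivAt_gb h₁ h₂ β y).const_mul c).deriv
  have e' : deriv (fun x => c * gb' g₁ g₂ β x) x = c * gb'' g₁ g₂ β x :=
    ((hasDerivAt_gb' h₁ h₂ β x).const_mul c).deriv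
  simp only [Lop] at hL₁ hL₂ ⊢
  rw [e, e']
  simp only [gb, gb', gb'']
  linear_combination c * hL₂ - c * β * hL₁

theorem hasDerivAt_affine (k K x : ℝ) : HasDerivAt (fun x => k * x - K) k x := by
  simpa using ((hasDerivAt_id x).const_mul k).sub_const K

theorem Lop_affine (mu sig : ℝ → ℝ) (lam k K x : ℝ) :
    Lop mu sig lam (fun x => k * x - K) x = mu x * k - lam * (k * x - K) := by
  have e : deriv (fun x : ℝ => k * x - K) = fun _ => k :=
    funext fun y => (hasDerivAt_affine k K y).deriv
  simp [Lop, e]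

/-- The generator equation turns the ratio of second derivatives into a ratio of first-order terms. -/
theorem hfun_eq_div {mu sig : ℝ → ℝ} {lam : ℝ} {g₁ g₂ : ℝ → ℝ} {x : ℝ} (hs : 0 < sig x ^ 2)
    (hL₁ : Lop mu sig lam g₁ x = 0) (hL₂ : Lop mu sig lam g₂ x = 0) :
    hfun g₁ g₂ x = (lam * g₂ x - mu x * deriv g₂ x) / (lam * g₁ x - mu x * deriv g₁ x) := by
  simp only [Lop] at hL₁ hL₂
  rw [show lam * g₂ x - mu x * deriv g₂ x = (1 / 2 * sig x ^ 2) * deriv (deriv g₂) x by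
      linear_combination -hL₂,
    show lam * g₁ x - mu x * deriv g₁ x = (1 / 2 * sig x ^ 2) * deriv (deriv g₁) x by
      linear_combination -hL₁, mul_div_mul_left _ _ (by positivity), hfun]

theorem hasDerivAt_div_lam_sub_mu {mu sig : ℝ → ℝ} {lam : ℝ} {g₁ g₂ : ℝ → ℝ}
    (hmu : ContDiff ℝ 1 mu) (h₁ : ContDiff ℝ 2 g₁) (h₂ : ContDiff ℝ 2 g₂) {x : ℝ}
    (hs : 0 < sig x ^ 2)
    (hL₁ : Lop mu sig lam g₁ x = 0) (hL₂ : Lop mu sig lam g₂ x = 0)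
    (hne : deriv (deriv g₁) x ≠ 0) :
    HasDerivAt (fun x => (lam * g₂ x - mu x * deriv g₂ x) / (lam * g₁ x - mu x * deriv g₁ x))
      ((lam - deriv mu x) * (lam * Wron g₁ g₂ x / (lam * g₁ x - mu x * deriv g₁ x) ^ 2)) x := by
  have hm : HasDerivAt mu (deriv mu x) x := ((hmu.differentiable (by norm_num)) x).hasDerivAt
  obtain ⟨d₁, dd₁⟩ := h₁.hasDerivAt_of_two x
  obtain ⟨d₂, dd₂⟩ := h₂.hasDerivAt_of_two x
  simp only [Lop] at hL₁ hL₂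
  have hp : lam * g₁ x - mu x * deriv g₁ x ≠ 0 := by
    rw [show lam * g₁ x - mu x * deriv g₁ x = (1 / 2 * sig x ^ 2) * deriv (deriv g₁) x by
      linear_combination -hL₁]
    exact mul_ne_zero (by positivity) hne
  refine (((d₂.const_mul lam).sub (hm.mul dd₂)).div
    ((d₁.const_mul lam).sub (hm.mul dd₁)) hp).congr_deriv (Eq.symm ?_)
  rw [mul_div_assoc', Wron]
  congr 1
  simp only [Pi.sub_apply, Pi.mul_apply]
  linear_combination mu x * deriv (deriv g₁) x * hL₂ - mu x * deriv (deriv g₂) x * hL₁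

theorem gb''_eq {g₁ g₂ : ℝ → ℝ} {x : ℝ} (hne : deriv (deriv g₁) x ≠ 0) (β : ℝ) :
    gb'' g₁ g₂ β x = (hfun g₁ g₂ x - β) * deriv (deriv g₁) x := by
  rw [hfun, gb'']
  field_simp

theorem exists_eqOn_hfun_hasDerivAt {mu sig : ℝ → ℝ} {lam : ℝ} {g₁ g₂ : ℝ → ℝ} {s : Set ℝ}
    (hs0 : ∀ x ∈ s, 0 ≤ x) (hlam : 0 < lam)
    (hmu : ContDiff ℝ 1 mu) (h₁ : ContDiff ℝ 2 g₁) (h₂ : ContDiff ℝ 2 g₂)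
    (hsig : ∀ x : ℝ, 0 ≤ x → 0 < sig x ^ 2)
    (hL₁ : ∀ x : ℝ, 0 ≤ x → Lop mu sig lam g₁ x = 0)
    (hL₂ : ∀ x : ℝ, 0 ≤ x → Lop mu sig lam g₂ x = 0)
    (hW : ∀ x : ℝ, 0 ≤ x → 0 < Wron g₁ g₂ x)
    (hne : ∀ x ∈ s, deriv (deriv g₁) x ≠ 0) :
    ∃ q : ℝ → ℝ, EqOn q (hfun g₁ g₂) s ∧
      ∀ x ∈ s, ∃ w : ℝ, 0 < w ∧ HasDerivAt q ((lam - deriv mu x) * w) x := by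
  refine ⟨_, fun x hx => (hfun_eq_div (hsig x (hs0 x hx)) (hL₁ x (hs0 x hx))
    (hL₂ x (hs0 x hx))).symm, fun x hx => ⟨_, ?_, hasDerivAt_div_lam_sub_mu hmu h₁ h₂
      (hsig x (hs0 x hx)) (hL₁ x (hs0 x hx)) (hL₂ x (hs0 x hx)) (hne x hx)⟩⟩
  have hp : lam * g₁ x - mu x * deriv g₁ x ≠ 0 := by
    have h := hL₁ x (hs0 x hx)
    have := hsig x (hs0 x hx)
    simp only [Lop] at h
    rw [show lam * g₁ x - mu x * deriv g₁ x = (1 / 2 * sig x ^ 2) * deriv (deriv g₁) x by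
      linear_combination -h]
    exact mul_ne_zero (by positivity) (hne x hx)
  have := hW x (hs0 x hx)
  positivity

theorem hfun_strictAntiOn {mu sig : ℝ → ℝ} {lam : ℝ} {g₁ g₂ : ℝ → ℝ} {s : Set ℝ}
    (hc : Convex ℝ s) (hs0 : ∀ x ∈ s, 0 ≤ x) (hlam : 0 < lam)
    (hmu : ContDiff ℝ 1 mu) (h₁ : ContDiff ℝ 2 g₁) (h₂ : ContDiff ℝ 2 g₂)
    (hsig : ∀ x : ℝ, 0 ≤ x → 0 < sig x ^ 2)
    (hL₁ : ∀ x : ℝ, 0 ≤ x → Lop mu sig lam g₁ x = 0)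
    (hL₂ : ∀ x : ℝ, 0 ≤ x → Lop mu sig lam g₂ x = 0)
    (hW : ∀ x : ℝ, 0 ≤ x → 0 < Wron g₁ g₂ x)
    (hne : ∀ x ∈ s, deriv (deriv g₁) x ≠ 0)
    (hd : ∀ x ∈ interior s, lam < deriv mu x) : StrictAntiOn (hfun g₁ g₂) s := by
  obtain ⟨q, hq, hq'⟩ := exists_eqOn_hfun_hasDerivAt hs0 hlam hmu h₁ h₂ hsig hL₁ hL₂ hW hne
  refine StrictAntiOn.congr (strictAntiOn_of_deriv_neg hc ?_ fun x hx => ?_) hq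
  · intro x hx
    obtain ⟨w, -, h⟩ := hq' x hx
    exact h.continuousAt.continuousWithinAt
  · obtain ⟨w, hw, h⟩ := hq' x (interior_subset hx)
    rw [h.deriv]
    exact mul_neg_of_neg_of_pos (sub_neg.2 (hd x hx)) hw

theorem hfun_monotoneOn {mu sig : ℝ → ℝ} {lam : ℝ} {g₁ g₂ : ℝ → ℝ} {s : Set ℝ}
    (hc : Convex ℝ s) (hs0 : ∀ x ∈ s, 0 ≤ x) (hlam : 0 < lam)
    (hmu : ContDiff ℝ 1 mu) (h₁ : ContDiff ℝ 2 g₁) (h₂ : ContDiff ℝ 2 g₂)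
    (hsig : ∀ x : ℝ, 0 ≤ x → 0 < sig x ^ 2)
    (hL₁ : ∀ x : ℝ, 0 ≤ x → Lop mu sig lam g₁ x = 0)
    (hL₂ : ∀ x : ℝ, 0 ≤ x → Lop mu sig lam g₂ x = 0)
    (hW : ∀ x : ℝ, 0 ≤ x → 0 < Wron g₁ g₂ x)
    (hne : ∀ x ∈ s, deriv (deriv g₁) x ≠ 0)
    (hd : ∀ x ∈ s, deriv mu x ≤ lam) : MonotoneOn (hfun g₁ g₂) s := by
  obtain ⟨q, hq, hq'⟩ := exists_eqOn_hfun_hasDerivAt hs0 hlam hmu h₁ h₂ hsig hL₁ hL₂ hW hne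
  refine MonotoneOn.congr (monotoneOn_of_deriv_nonneg hc ?_ ?_ fun x hx => ?_) hq
  · intro x hx
    obtain ⟨w, -, h⟩ := hq' x hx
    exact h.continuousAt.continuousWithinAt
  · intro x hx
    obtain ⟨w, -, h⟩ := hq' x (interior_subset hx)
    exact h.differentiableAt.differentiableWithinAt
  · obtain ⟨w, hw, h⟩ := hq' x (interior_subset hx)
    rw [h.deriv]
    exact mul_nonneg (sub_nonneg.2 (hd x (interior_subset hx))) hw.le

/-- A function that is strictly convex and then concave, with equal slopes at the two ends,
lies strictly above its initial tangent at the right end. -/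
theorem slope_mul_lt_sub_of_convex_concave {f f' f'' : ℝ → ℝ} {a b c : ℝ}
    (hab : a < b) (hbc : b ≤ c)
    (hf : ∀ x, HasDerivAt f (f' x) x) (hf' : ∀ x, HasDerivAt f' (f'' x) x)
    (hpos : ∀ x ∈ Ioo a b, 0 < f'' x) (hneg : ∀ x ∈ Ioo b c, f'' x ≤ 0)
    (hac : f' a = f' c) : f' a * (c - a) < f c - f a := by
  have m1 : StrictMonoOn f' (Icc a b) := by
    refine strictMonoOn_of_deriv_pos (convex_Icc a b)
      (fun x _ => (hf' x).continuousAt.continuousWithinAt) fun x hx => ?_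
    rw [interior_Icc] at hx
    rw [(hf' x).deriv]
    exact hpos x hx
  have m2 : AntitoneOn f' (Icc b c) := by
    refine antitoneOn_of_deriv_nonpos (convex_Icc b c)
      (fun x _ => (hf' x).continuousAt.continuousWithinAt)
      (fun x _ => (hf' x).differentiableAt.differentiableWithinAt) fun x hx => ?_
    rw [interior_Icc] at hx
    rw [(hf' x).deriv]
    exact hneg x hx
  have hG : ∀ x, HasDerivAt (fun x => f x - f' a * x) (f' x - f' a) x := fun x =>
    ((hf x).sub ((hasDerivAt_id x).const_mul (f' a))).congr_deriv (by simp)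
  have l1 : StrictMonoOn (fun x => f x - f' a * x) (Icc a b) := by
    refine strictMonoOn_of_deriv_pos (convex_Icc a b)
      (fun x _ => (hG x).continuousAt.continuousWithinAt) fun x hx => ?_
    rw [interior_Icc] at hx
    rw [(hG x).deriv]
    exact sub_pos.2 (m1 ⟨le_rfl, hab.le⟩ ⟨hx.1.le, hx.2.le⟩ hx.1)
  have l2 : MonotoneOn (fun x => f x - f' a * x) (Icc b c) := by
    refine monotoneOn_of_deriv_nonneg (convex_Icc b c)
      (fun x _ => (hG x).continuousAt.continuousWithinAt)
      (fun x _ => (hG x).differentiableAt.differentiableWithinAt) fun x hx => ?_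
    rw [interior_Icc] at hx
    rw [(hG x).deriv, hac]
    exact sub_nonneg.2 (m2 ⟨hx.1.le, hx.2.le⟩ ⟨hbc, le_rfl⟩ hx.2.le)
  have e1 := l1 ⟨le_rfl, hab.le⟩ ⟨hab.le, le_rfl⟩ hab
  have e2 := l2 ⟨le_rfl, hbc⟩ ⟨hbc, le_rfl⟩ hbc
  simp only at e1 e2
  nlinarith

theorem mul_deriv_le_sub_of_concave {f f' f'' : ℝ → ℝ} {a : ℝ} (ha : 0 < a)
    (hf : ∀ x, HasDerivAt f (f' x) x) (hf' : ∀ x, HasDerivAt f' (f'' x) x)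
    (hneg : ∀ x ∈ Ioo 0 a, f'' x ≤ 0) : a * f' a ≤ f a - f 0 := by
  have m : AntitoneOn f' (Icc 0 a) := by
    refine antitoneOn_of_deriv_nonpos (convex_Icc 0 a)
      (fun x _ => (hf' x).continuousAt.continuousWithinAt)
      (fun x _ => (hf' x).differentiableAt.differentiableWithinAt) fun x hx => ?_
    rw [interior_Icc] at hx
    rw [(hf' x).deriv]
    exact hneg x hx
  obtain ⟨c, hc, he⟩ := exists_hasDerivAt_eq_slope f f' ha
    (fun x _ => (hf x).continuousAt.continuousWithinAt) fun x _ => hf x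
  have := m ⟨hc.1.le, hc.2.le⟩ ⟨ha.le, le_rfl⟩ hc.2.le
  rw [he, sub_zero, le_div_iff₀ ha] at this
  linarith

theorem deriv_pos_and_eq_of_gam_eq_zero {k K β x : ℝ} {g₁ g₂ : ℝ → ℝ} (hk : 0 < k) (hx : K < k * x)
    (hg : 0 < gb g₁ g₂ β x) (h : gam k K g₁ g₂ β x = 0) :
    0 < gb' g₁ g₂ β x ∧ k / gb' g₁ g₂ β x * gb g₁ g₂ β x = k * x - K := by
  have e : k * (gb g₁ g₂ β x / gb' g₁ g₂ β x) = k * x - K := by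
    rw [gam] at h
    linarith
  have hpos : 0 < gb g₁ g₂ β x / gb' g₁ g₂ β x := by
    have : 0 < k * (gb g₁ g₂ β x / gb' g₁ g₂ β x) := by linarith
    exact pos_of_mul_pos_right this hk.le
  refine ⟨(div_pos_iff_of_pos_left hg).1 hpos, ?_⟩
  rw [← e]
  ring

theorem contDiff_one_Vfun {k K cstar ctil bt ubar u1t u3t : ℝ} {g₁ g₂ : ℝ → ℝ}
    (h₁ : ContDiff ℝ 2 g₁) (h₂ : ContDiff ℝ 2 g₂) (h12 : ubar < u1t) (h23 : u1t < u3t)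
    (e1 : cstar * gb g₁ g₂ 1 ubar = k * ubar - K) (d1 : cstar * gb' g₁ g₂ 1 ubar = k)
    (e2 : ctil * gb g₁ g₂ bt u1t = k * u1t - K) (d2 : ctil * gb' g₁ g₂ bt u1t = k)
    (e3 : ctil * gb g₁ g₂ bt u3t = k * u3t - K) (d3 : ctil * gb' g₁ g₂ bt u3t = k) :
    ContDiff ℝ 1 (Vfun k K cstar ctil bt ubar u1t u3t g₁ g₂) := by
  have dg : ∀ c β x, deriv (fun x => c * gb g₁ g₂ β x) x = c * gb' g₁ g₂ β x :=
    fun c β x => ((hasDerivAt_gb h₁ h₂ β x).const_mul c).deriv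
  have cg : ∀ c β, ContDiff ℝ 1 (fun x => c * gb g₁ g₂ β x) :=
    fun c β => (contDiff_const_mul_gb h₁ h₂ c β).of_le (by norm_num)
  have ca : ContDiff ℝ 1 (fun x : ℝ => k * x - K) := by fun_prop
  have da : ∀ x, deriv (fun x : ℝ => k * x - K) x = k := fun x => (hasDerivAt_affine k K x).deriv
  have C3 := (cg ctil bt).if_lt_of_deriv_eq ca (a := u3t) e3 (by rw [dg, da, d3])
  have C2 := ca.if_lt_of_deriv_eq C3 (a := u1t) (by simp only [if_pos h23, e2]) (by
    rw [da, ← d2, ← dg]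
    refine Filter.EventuallyEq.deriv_eq ?_
    filter_upwards [Iio_mem_nhds h23] with y hy
    exact (if_pos hy).symm)
  refine (cg cstar 1).if_lt_of_deriv_eq C2 (a := ubar) (by simp only [if_pos h12, e1]) ?_
  rw [dg, d1]
  refine (da ubar).symm.trans ?_
  refine Filter.EventuallyEq.deriv_eq ?_
  filter_upwards [Iio_mem_nhds h12] with y hy
  exact (if_pos hy).symm

theorem Vfun_eventuallyEq {k K cstar ctil bt ubar u1t u3t : ℝ} {g₁ g₂ : ℝ → ℝ}
    (h12 : ubar < u1t) (h23 : u1t < u3t) {x : ℝ} :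
    (x < ubar → Vfun k K cstar ctil bt ubar u1t u3t g₁ g₂ =ᶠ[𝓝 x]
      fun x => cstar * gb g₁ g₂ 1 x) ∧
    (x ∈ Ioo u1t u3t → Vfun k K cstar ctil bt ubar u1t u3t g₁ g₂ =ᶠ[𝓝 x]
      fun x => ctil * gb g₁ g₂ bt x) ∧
    (x ∈ Ioo ubar u1t ∪ Ioi u3t → Vfun k K cstar ctil bt ubar u1t u3t g₁ g₂ =ᶠ[𝓝 x]
      fun x => k * x - K) := by
  refine ⟨fun h => ?_, fun h => ?_, fun h => ?_⟩
  · filter_upwards [Iio_mem_nhds h] with y hy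
    exact if_pos hy
  · filter_upwards [Ioo_mem_nhds h.1 h.2] with y hy
    rw [Vfun, if_neg (by linarith [hy.1]), if_neg (by linarith [hy.1]), if_pos hy.2]
  · rcases h with h | h
    · filter_upwards [Ioo_mem_nhds h.1 h.2] with y hy
      rw [Vfun, if_neg (by linarith [hy.1]), if_pos hy.2]
    · filter_upwards [Ioi_mem_nhds h] with y hy
      have hy : u3t < y := hy
      rw [Vfun, if_neg (by linarith), if_neg (by linarith), if_neg (by linarith)]

theorem stmt_18    (lam k K C xlam : ℝ) (mu sig : ℝ → ℝ)
    (hlam : 0 < lam) (hk : 0 < k) (hK : 0 < K) (hC : 0 < C)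
    (hA1 : ∀ x : ℝ, 0 ≤ x → |mu x| + |sig x| ≤ C * (1 + x))
    (hA2mu : ContDiff ℝ 1 mu) (hA2sig : ContDiff ℝ 1 sig)
    (hA2muL : ∃ M : NNReal, LipschitzWith M mu)
    (hA2sigL : ∃ M : NNReal, LipschitzWith M sig)
    (hA2muL' : ∃ M : NNReal, LipschitzWith M (deriv mu))
    (hA2sigL' : ∃ M : NNReal, LipschitzWith M (deriv sig))
    (hA3 : ∀ x : ℝ, 0 ≤ x → 0 < (sig x)^2)
    (hxlam : 0 ≤ xlam)
    (hA4a : ∀ x : ℝ, 0 ≤ x → x < xlam → lam < deriv mu x)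
    (hA4b : ∀ x : ℝ, xlam ≤ x → deriv mu x ≤ lam)
    (g₁ g₂ : ℝ → ℝ)
    (hg₁C : ContDiff ℝ 2 g₁) (hg₂C : ContDiff ℝ 2 g₂)
    (hg₁pos : ∀ x : ℝ, 0 ≤ x → 0 < g₁ x) (hg₂pos : ∀ x : ℝ, 0 ≤ x → 0 < g₂ x)
    (hg₁L : ∀ x : ℝ, 0 ≤ x → Lop mu sig lam g₁ x = 0)
    (hg₂L : ∀ x : ℝ, 0 ≤ x → Lop mu sig lam g₂ x = 0)
    (hg₁z : g₁ 0 = 1) (hg₂z : g₂ 0 = 1)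
    (hg₁d : ∀ x : ℝ, 0 ≤ x → x < xlam → deriv g₁ x < 0)
    (hg₁dx : deriv g₁ xlam = 0)
    (hg₁di : ∀ x : ℝ, xlam < x → 0 < deriv g₁ x)
    (hg₁dd : ∀ x : ℝ, xlam ≤ x → 0 < deriv (deriv g₁) x)
    (hg₂mono : StrictMonoOn g₂ (Ici (0:ℝ)))
    (hg₂d0 : 0 < deriv g₂ 0)
    (z₀ : ℝ) (hz₀ge : 0 ≤ z₀) (hz₀lt : z₀ < xlam)
    (hz₀eq : 0 ≤ deriv (deriv g₁) 0 → z₀ = 0)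
    (hz₀a : ∀ x : ℝ, 0 < x → x < z₀ → deriv (deriv g₁) x < 0)
    (hz₀b : ∀ x : ℝ, z₀ < x → x < xlam → 0 < deriv (deriv g₁) x)
    (hW : ∀ x : ℝ, 0 ≤ x → 0 < Wron g₁ g₂ x)
    (hgd : ∀ x : ℝ, 0 ≤ x → 0 < gb' g₁ g₂ 1 x)
    (x₁ : ℝ) (hx₁a : z₀ < x₁) (hx₁b : x₁ ≤ xlam)
    (hx₁c : ∀ x : ℝ, 0 ≤ x → x < x₁ → 0 < gb'' g₁ g₂ 1 x)
    (hx₁d : gb'' g₁ g₂ 1 x₁ = 0)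
    (hmux : 0 < mu xlam * k - lam * (k * xlam - K))
    (z : ℝ) (hza : x₁ < z) (hzb : z < xlam)
    (hzc : mu z * k - lam * (k * z - K) = 0)
    (hzd : ∀ x : ℝ, 0 ≤ x → x < z → mu x * k - lam * (k * x - K) < 0)
    (ubar : ℝ) (hubar0 : 0 < ubar) (hubar1 : ubar < x₁)
    (hubarg : gam k K g₁ g₂ 1 ubar = 0)
    (hinv : ℝ → ℝ)
    (hhinv : ∀ β : ℝ, hfun g₁ g₂ z ≤ β → β ≤ 1 →
      x₁ ≤ hinv β ∧ hinv β ≤ z ∧ hfun g₁ g₂ (hinv β) = β ∧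
      (∀ y : ℝ, x₁ ≤ y → y ≤ z → hfun g₁ g₂ y = β → y = hinv β))
    (bt : ℝ) (hbt1 : hfun g₁ g₂ z < bt) (hbt2 : bt < 1)
    (xp : ℝ) (hxp1 : xlam < xp) (hxp2 : hfun g₁ g₂ xp = bt)
    (u1t : ℝ) (hu1ta : ubar < u1t) (hu1tb : u1t < hinv bt)
    (hu1tg : gam k K g₁ g₂ bt u1t = 0)
    (u3t : ℝ) (hu3ta : xp < u3t)
    (hu3tb : gb' g₁ g₂ bt u3t = gb' g₁ g₂ bt u1t)
    (hu3tJ : Jfun k g₁ g₂ bt u1t u3t = 0)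
    (cstar ctil : ℝ) (V : ℝ → ℝ)
    (hcstar : cstar = k / gb' g₁ g₂ 1 ubar)
    (hctil : ctil = k / gb' g₁ g₂ bt u1t)
    (hV : V = Vfun k K cstar ctil bt ubar u1t u3t g₁ g₂) :
    ContDiffOn ℝ 1 V (Ioi 0) ∧
    ContDiffOn ℝ 2 V (Ioi 0 \ {ubar, u1t, u3t}) ∧
    (∀ x ∈ Ioo 0 ubar ∪ Ioo u1t u3t, Lop mu sig lam V x = 0) ∧
    (∀ x ∈ Ioo ubar u1t ∪ Ioi u3t, Lop mu sig lam V x < 0) := by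
  subst hV hcstar hctil
  have hdg := hasDerivAt_gb hg₁C hg₂C
  have hdg' := hasDerivAt_gb' hg₁C hg₂C
  have hg1dd : ∀ x, z₀ < x → 0 < deriv (deriv g₁) x := fun x hx =>
    (lt_or_ge x xlam).elim (hz₀b x hx) (hg₁dd x)
  have hg1ddz : 0 ≤ deriv (deriv g₁) z₀ := by
    have hc : Continuous (deriv (deriv g₁)) := by
      have := hg₁C.continuous_iteratedDeriv 2 le_rfl
      simpa [iteratedDeriv_succ, iteratedDeriv_zero] using this
    refine ge_of_tendsto (hc.continuousAt.tendsto.mono_left (nhdsWithin_le_nhds (s := Ioi z₀))) ?_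
    filter_upwards [self_mem_nhdsWithin] with y hy
    exact (hg1dd y hy).le
  have anti₀ : StrictAntiOn (hfun g₁ g₂) (Ioo 0 z₀) :=
    hfun_strictAntiOn (convex_Ioo _ _) (fun x hx => hx.1.le) hlam hA2mu hg₁C hg₂C hA3 hg₁L hg₂L hW
      (fun x hx => (hz₀a x hx.1 hx.2).ne) fun x hx => by
        rw [interior_Ioo] at hx
        exact hA4a x hx.1.le (hx.2.trans hz₀lt)
  have anti₁ : StrictAntiOn (hfun g₁ g₂) (Ioc z₀ xlam) :=
    hfun_strictAntiOn (convex_Ioc _ _) (fun x hx => hz₀ge.trans hx.1.le) hlam hA2mu hg₁C hg₂C hA3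
      hg₁L hg₂L hW (fun x hx => (hg1dd x hx.1).ne') fun x hx => by
        rw [interior_Ioc] at hx
        exact hA4a x (hz₀ge.trans hx.1.le) hx.2
  have mono₂ : MonotoneOn (hfun g₁ g₂) (Ici xlam) :=
    hfun_monotoneOn (convex_Ici _) (fun x hx => hxlam.trans hx) hlam hA2mu hg₁C hg₂C hA3
      hg₁L hg₂L hW (fun x hx => (hg₁dd x hx).ne') fun x hx => hA4b x hx
  obtain ⟨hxm1, hxm2, hxm3, -⟩ := hhinv bt hbt1.le hbt2.le
  set xm := hinv bt
  have hz₀xm : z₀ < xm := hx₁a.trans_le hxm1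
  have hu13 : u1t < u3t := by linarith
  have hu1pos : 0 < u1t := hubar0.trans hu1ta
  have g_pos : ∀ x, 0 < x → 0 < gb g₁ g₂ 1 x := by
    intro x hx
    have hm : StrictMonoOn (gb g₁ g₂ 1) (Ici 0) :=
      strictMonoOn_of_deriv_pos (convex_Ici 0)
        (fun y _ => (hdg 1 y).continuousAt.continuousWithinAt) fun y hy => by
          rw [(hdg 1 y).deriv]
          exact hgd y (interior_subset hy)
    have := hm self_mem_Ici hx.le hx
    simpa [gb, hg₁z, hg₂z] using this
  have gbt_pos : 0 < gb g₁ g₂ bt u1t := by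
    have h1 := g_pos u1t hu1pos
    have h2 := hg₁pos u1t hu1pos.le
    simp only [gb] at h1 ⊢
    nlinarith
  have hd1 := hgd ubar hubar0.le
  have hKubar : K < k * ubar := by
    have h1 : 0 < k * (gb g₁ g₂ 1 ubar / gb' g₁ g₂ 1 ubar) :=
      mul_pos hk (div_pos (g_pos ubar hubar0) hd1)
    rw [gam] at hubarg
    linarith
  have e1 := (deriv_pos_and_eq_of_gam_eq_zero hk hKubar (g_pos ubar hubar0) hubarg).2
  have hKu1 : K < k * u1t := hKubar.trans (mul_lt_mul_of_pos_left hu1ta hk)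
  obtain ⟨hd2, e2⟩ := deriv_pos_and_eq_of_gam_eq_zero hk hKu1 gbt_pos hu1tg
  have hJ : gb' g₁ g₂ bt u1t * (u3t - u1t) = gb g₁ g₂ bt u3t - gb g₁ g₂ bt u1t := by
    rw [Jfun, hu3tb, mul_eq_zero, or_iff_right hk.ne', sub_eq_zero, eq_div_iff hd2.ne'] at hu3tJ
    linarith
  have dtil : k / gb' g₁ g₂ bt u1t * gb' g₁ g₂ bt u1t = k := div_mul_cancel₀ _ hd2.ne'
  have e3 : k / gb' g₁ g₂ bt u1t * gb g₁ g₂ bt u3t = k * u3t - K := by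
    linear_combination e2 + (u3t - u1t) * dtil - k / gb' g₁ g₂ bt u1t * hJ
  have gdd_right : ∀ x, z₀ ≤ x → x < xm → 0 < gb'' g₁ g₂ bt x := by
    intro x hx hxm
    rcases lt_or_ge x x₁ with h | h
    · have h1 := hx₁c x (hz₀ge.trans hx) h
      have h2 : 0 ≤ deriv (deriv g₁) x := by
        rcases hx.eq_or_lt with rfl | h'
        · exact hg1ddz
        · exact (hg1dd x h').le
      simp only [gb''] at h1 ⊢
      nlinarith
    · have hzx : z₀ < x := hx₁a.trans_le h
      have := hg1dd x hzx
      rw [gb''_eq this.ne']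
      have h' := anti₁ ⟨hzx, by linarith⟩ ⟨hz₀xm, by linarith⟩ hxm
      exact mul_pos (by linarith) this
  have gdd_u1 : 0 < gb'' g₁ g₂ bt u1t := by
    by_contra! hcon
    have hlt : u1t < z₀ := by
      by_contra! h
      exact hcon.not_gt (gdd_right u1t h hu1tb)
    have hneg := hz₀a u1t hu1pos hlt
    rw [gb''_eq hneg.ne] at hcon
    have hge : bt ≤ hfun g₁ g₂ u1t := by
      by_contra! h
      exact hcon.not_gt (mul_pos_of_neg_of_neg (by linarith) hneg)
    have hle := mul_deriv_le_sub_of_concave hu1pos (hdg bt) (hdg' bt) fun x hx => by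
      have hx' := hz₀a x hx.1 (hx.2.trans hlt)
      rw [gb''_eq hx'.ne]
      have := anti₀ ⟨hx.1, hx.2.trans hlt⟩ ⟨hu1pos, hlt⟩ hx.2
      exact mul_nonpos_of_nonneg_of_nonpos (by linarith) hx'.le
    have h0 : gb g₁ g₂ bt 0 = 1 - bt := by simp [gb, hg₁z, hg₂z]
    have : k * gb g₁ g₂ bt u1t = (k * u1t - K) * gb' g₁ g₂ bt u1t := by
      rw [← e2]
      field_simp
    rw [h0] at hle
    linarith [mul_pos hK hd2, mul_le_mul_of_nonneg_left hle hk.le, mul_pos hk (sub_pos.2 hbt2)]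
  have gdd_left : ∀ x ∈ Ioo u1t xm, 0 < gb'' g₁ g₂ bt x := by
    intro x hx
    rcases le_or_gt z₀ x with h | h
    · exact gdd_right x h hx.2
    · have hu := hz₀a u1t hu1pos (hx.1.trans h)
      have hx0 := hz₀a x (hu1pos.trans hx.1) h
      rw [gb''_eq hu.ne] at gdd_u1
      rw [gb''_eq hx0.ne]
      have := anti₀ ⟨hu1pos, hx.1.trans h⟩ ⟨hu1pos.trans hx.1, h⟩ hx.1
      have h3 : hfun g₁ g₂ u1t - bt < 0 := neg_of_mul_pos_left gdd_u1 hu.le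
      exact mul_pos_of_neg_of_neg (by linarith) hx0
  have hu3dd : 0 < deriv (deriv g₁) u3t := hg₁dd u3t (by linarith)
  have hu3h : bt < hfun g₁ g₂ u3t := by
    refine lt_of_le_of_ne (hxp2 ▸ mono₂ hxp1.le (hxp1.trans hu3ta).le hu3ta.le) fun heq => ?_
    refine (slope_mul_lt_sub_of_convex_concave hu1tb (by linarith) (hdg bt) (hdg' bt)
      gdd_left (fun x hx => ?_) hu3tb.symm).ne hJ
    have hx0 := hg1dd x (hz₀xm.trans hx.1)
    rw [gb''_eq hx0.ne']
    refine mul_nonpos_of_nonpos_of_nonneg (sub_nonpos.2 ?_) hx0.le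
    rcases le_or_gt x xlam with h | h
    · exact hxm3 ▸ (anti₁ ⟨hz₀xm, by linarith⟩ ⟨hz₀xm.trans hx.1, h⟩ hx.1).le
    · exact heq ▸ mono₂ h.le (hxp1.trans hu3ta).le hx.2.le
  have hneg3 : mu u3t * k - lam * (k * u3t - K) < 0 := by
    have h0 : 0 ≤ u3t := by linarith
    have hL₁ := hg₁L u3t h0
    have hL₂ := hg₂L u3t h0
    have hpos : 0 < k / gb' g₁ g₂ bt u1t * (1 / 2 * sig u3t ^ 2 * gb'' g₁ g₂ bt u3t) := by
      have h1 := hA3 u3t h0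
      have h2 : 0 < gb'' g₁ g₂ bt u3t := by
        rw [gb''_eq hu3dd.ne']
        exact mul_pos (by linarith) hu3dd
      positivity
    have d3 : k / gb' g₁ g₂ bt u1t * gb' g₁ g₂ bt u3t = k := by rw [hu3tb, dtil]
    have hz : 1 / 2 * sig u3t ^ 2 * gb'' g₁ g₂ bt u3t + mu u3t * gb' g₁ g₂ bt u3t
        - lam * gb g₁ g₂ bt u3t = 0 := by
      simp only [Lop] at hL₁ hL₂
      simp only [gb, gb', gb'']
      linear_combination hL₂ - bt * hL₁
    have : mu u3t * k - lam * (k * u3t - K)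
        = -(k / gb' g₁ g₂ bt u1t * (1 / 2 * sig u3t ^ 2 * gb'' g₁ g₂ bt u3t)) := by
      linear_combination k / gb' g₁ g₂ bt u1t * hz - mu u3t * d3 + lam * e3
    linarith
  have hanti : AntitoneOn (fun x => mu x * k - lam * (k * x - K)) (Ici xlam) := by
    have hd : ∀ x, HasDerivAt (fun x => mu x * k - lam * (k * x - K))
        (deriv mu x * k - lam * k) x := fun x =>
      (((hA2mu.differentiable (by norm_num)) x).hasDerivAt.mul_const k).sub
        ((hasDerivAt_affine k K x).const_mul lam)
    refine antitoneOn_of_deriv_nonpos (convex_Ici _)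
      (fun x _ => (hd x).continuousAt.continuousWithinAt)
      (fun x _ => (hd x).differentiableAt.differentiableWithinAt) fun x hx => ?_
    rw [(hd x).deriv, ← sub_mul]
    exact mul_nonpos_of_nonpos_of_nonneg (sub_nonpos.2 (hA4b x (interior_subset hx))) hk.le
  refine ⟨(contDiff_one_Vfun hg₁C hg₂C hu1ta hu13 e1 (div_mul_cancel₀ _ hd1.ne') e2 dtil e3
    (by rw [hu3tb, dtil])).contDiffOn, fun x hx => ContDiffAt.contDiffWithinAt ?_,
    fun x hx => ?_, fun x hx => ?_⟩
  · obtain ⟨c1, c2, c3⟩ := Vfun_eventuallyEq (k := k) (K := K) (bt := bt) (g₁ := g₁) (g₂ := g₂)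
      (cstar := k / gb' g₁ g₂ 1 ubar) (ctil := k / gb' g₁ g₂ bt u1t) hu1ta hu13 (x := x)
    have ca : ContDiff ℝ 2 (fun x : ℝ => k * x - K) := by fun_prop
    obtain ⟨-, hx⟩ := hx
    simp only [mem_insert_iff, mem_singleton_iff, not_or] at hx
    rcases lt_or_gt_of_ne hx.1 with h1 | h1
    · exact (contDiff_const_mul_gb hg₁C hg₂C _ _).contDiffAt.congr_of_eventuallyEq (c1 h1)
    rcases lt_or_gt_of_ne hx.2.1 with h2 | h2
    · exact ca.contDiffAt.congr_of_eventuallyEq (c3 (Or.inl ⟨h1, h2⟩))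
    rcases lt_or_gt_of_ne hx.2.2 with h3 | h3
    · exact (contDiff_const_mul_gb hg₁C hg₂C _ _).contDiffAt.congr_of_eventuallyEq (c2 ⟨h2, h3⟩)
    · exact ca.contDiffAt.congr_of_eventuallyEq (c3 (Or.inr h3))
  · rcases hx with hx | hx
    · rw [Lop_congr ((Vfun_eventuallyEq hu1ta hu13).1 hx.2)]
      exact Lop_const_mul_gb hg₁C hg₂C (hg₁L x hx.1.le) (hg₂L x hx.1.le) _ _
    · have h0 : 0 ≤ x := (hu1pos.trans hx.1).le
      rw [Lop_congr ((Vfun_eventuallyEq hu1ta hu13).2.1 hx)]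
      exact Lop_const_mul_gb hg₁C hg₂C (hg₁L x h0) (hg₂L x h0) _ _
  · rw [Lop_congr ((Vfun_eventuallyEq hu1ta hu13).2.2 hx), Lop_affine]
    rcases hx with hx | hx
    · exact hzd x (hubar0.trans hx.1).le (by linarith [hx.2])
    · exact (hanti (hxp1.trans hu3ta).le ((hxp1.trans hu3ta).trans hx).le (le_of_lt hx)).trans_lt
        hneg3
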